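/- arXiv:1803.04005 — 2 statements merged into one kernel-verified Lean document; each statement's English description precedes it below -/
import Mathlib

section
/- Let n ≥ 2, d ≥ 3, and let f ∈ ℂ[z_1,…,z_n]_d be a nondegenerate form. Then in the Milnor algebra M_f := ℂ[z_1,…,z_n]/(f_{z_1},…,f_{z_n}), the socle Soc(M_f) := {x ∈ M_f : x·𝔪 = 0}, where 𝔪 is the maximal ideal generated by the classes of z_1,…,z_n, is a one-dimensional ℂ-vector space spanned by the class of the Hessian Hess(f) := det(∂²f/∂z_i∂z_j); in particular Hess(f) ∉ (f_{z_1},…,f_{z_n}). -/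
open MvPolynomial

open scoped TensorProduct

namespace MvPolynomial

section Monomial

variable {σ k : Type*} [Field k]

/-- Membership in an ideal generated by powers of some of the variables. -/
theorem mem_span_X_pow_image_iff (m : ℕ) (s : Set σ) (p : MvPolynomial σ k) :
    p ∈ Ideal.span ((fun i => (X i : MvPolynomial σ k) ^ m) '' s) ↔
      ∀ e ∈ p.support, ∃ i ∈ s, m ≤ e i := by
  have : (fun i => (X i : MvPolynomial σ k) ^ m) '' s =
      (fun e => monomial e (1 : k)) '' ((fun i => Finsupp.single i m) '' s) := by
    simp [Set.image_image, X_pow_eq_monomial]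
  rw [this, mem_ideal_span_monomial_image]
  simp

/-- A variable is a nonzerodivisor modulo powers of other variables. -/
theorem mem_span_X_pow_image_of_X_mul_mem {m : ℕ} {s : Set σ} {j : σ} (hj : j ∉ s)
    {p : MvPolynomial σ k}
    (hp : X j * p ∈ Ideal.span ((fun i => (X i : MvPolynomial σ k) ^ m) '' s)) :
    p ∈ Ideal.span ((fun i => (X i : MvPolynomial σ k) ^ m) '' s) := by
  classical
  rw [mem_span_X_pow_image_iff] at hp ⊢
  intro e he
  obtain ⟨i, hi, hle⟩ := hp (Finsupp.single j 1 + e) (by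
    rw [mem_support_iff, coeff_X_mul]
    exact mem_support_iff.mp he)
  have hij : j ≠ i := fun h => hj (h ▸ hi)
  exact ⟨i, hi, by simpa [Finsupp.single_apply, hij] using hle⟩

theorem prod_X_pow_notMem_span_X_pow [Fintype σ] (N : ℕ) :
    ∏ i, (X i : MvPolynomial σ k) ^ N ∉
      Ideal.span (Set.range fun i => (X i : MvPolynomial σ k) ^ (N + 1)) := by
  classical
  have hprod : ∏ i, (X i : MvPolynomial σ k) ^ N =
      monomial (∑ i, Finsupp.single i N) 1 := by
    simp [X_pow_eq_monomial, monomial_sum_one]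
  rw [← Set.image_univ, mem_span_X_pow_image_iff, hprod]
  intro h
  obtain ⟨i, -, hi⟩ := h (∑ i, Finsupp.single i N) (by simp)
  simp [Finsupp.single_apply, Finsupp.finsetSum_apply] at hi

end Monomial

section Determinant

variable {ι R : Type*} [Fintype ι] [DecidableEq ι] [CommRing R]

theorem _root_.Matrix.det_mul_eq_sum_adjugate_mul (A : Matrix ι ι R) (v : ι → R) (j : ι) :
    A.det * v j = ∑ i, A.adjugate j i * (A.mulVec v) i := by
  have h : A.adjugate.mulVec (A.mulVec v) = A.det • v := by
    rw [Matrix.mulVec_mulVec, Matrix.adjugate_mul, Matrix.smul_mulVec, Matrix.one_mulVec]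
  simpa [Matrix.mulVec, dotProduct] using (congrFun h j).symm

theorem _root_.Matrix.det_mul_mem_span_mulVec (A : Matrix ι ι R) (v : ι → R) (j : ι) :
    A.det * v j ∈ Ideal.span (Set.range (A.mulVec v)) := by
  rw [A.det_mul_eq_sum_adjugate_mul]
  exact Ideal.sum_mem _ fun i _ => Ideal.mul_mem_left _ _ (Ideal.subset_span ⟨i, rfl⟩)

theorem _root_.Matrix.det_mul_mem_span_mulVec_of_mem (A : Matrix ι ι R) (v : ι → R) {r : R}
    (hr : r ∈ Ideal.span (Set.range v)) :
    A.det * r ∈ Ideal.span (Set.range (A.mulVec v)) := by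
  obtain ⟨c, rfl⟩ := Ideal.mem_span_range_iff_exists_fun.mp hr
  rw [Finset.mul_sum]
  refine Ideal.sum_mem _ fun i _ => ?_
  rw [mul_left_comm]
  exact Ideal.mul_mem_left _ _ (A.det_mul_mem_span_mulVec v i)

variable {k : Type*} [Field k]

/-- Modulo `(X i ^ m)`, the determinant of a matrix sending the variables to their `m`-th powers
does not depend on the matrix. -/
theorem det_sub_det_mem_span_X_pow {m : ℕ} (C D : Matrix ι ι (MvPolynomial ι k))
    (hC : C.mulVec X = fun i => X i ^ m) (hD : D.mulVec X = fun i => X i ^ m) :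
    C.det - D.det ∈ Ideal.span (Set.range fun i => (X i : MvPolynomial ι k) ^ m) := by
  set Q := Ideal.span (Set.range fun i => (X i : MvPolynomial ι k) ^ m)
  let M : Finset ι → Matrix ι ι (MvPolynomial ι k) := fun s i => if i ∈ s then C i else D i
  suffices h : ∀ s : Finset ι, (M s).det - D.det ∈ Q by
    simpa [M] using h Finset.univ
  intro s
  induction s using Finset.induction_on with
  | empty => simp [M]
  | insert j s hj ih =>
    suffices h : (M (insert j s)).det - (M s).det ∈ Q by
      simpa using Q.add_mem h ih
    set E := (M s).updateRow j (C j - D j) with hE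
    have hM : M (insert j s) = (M s).updateRow j ((C j - D j) + D j) := by
      refine _root_.funext fun i => ?_
      by_cases hi : i = j
      · subst hi
        rw [Matrix.updateRow_self, sub_add_cancel]
        simp [M]
      · rw [Matrix.updateRow_ne hi]
        simp [M, hi]
    have hMs : (M s).updateRow j (D j) = M s := by
      convert (M s).updateRow_eq_self j using 2
      simp [M, hj]
    have hdet : (M (insert j s)).det - (M s).det = E.det := by
      rw [hM, Matrix.det_updateRow_add, hMs, add_sub_cancel_right]
    have hCi (i : ι) : C i ⬝ᵥ X = (X i : MvPolynomial ι k) ^ m := congrFun hC i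
    have hDi (i : ι) : D i ⬝ᵥ X = (X i : MvPolynomial ι k) ^ m := congrFun hD i
    have hmul : X j * E.det ∈
        Ideal.span ((fun i => (X i : MvPolynomial ι k) ^ m) '' {i | i ≠ j}) := by
      rw [mul_comm, E.det_mul_eq_sum_adjugate_mul]
      refine Ideal.sum_mem _ fun i _ => Ideal.mul_mem_left _ _ ?_
      by_cases hi : i = j
      · subst hi
        have : E.mulVec X i = 0 := by
          change E i ⬝ᵥ X = 0
          rw [hE, Matrix.updateRow_self, sub_dotProduct, hCi, hDi, sub_self]
        rw [this]
        exact Ideal.zero_mem _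
      · have : E.mulVec X i = X i ^ m := by
          change E i ⬝ᵥ X = X i ^ m
          rw [hE, Matrix.updateRow_ne hi]
          by_cases his : i ∈ s <;> simp [M, his, hCi, hDi]
        rw [this]
        exact Ideal.subset_span ⟨i, hi, rfl⟩
    rw [hdet]
    exact Ideal.span_mono (Set.image_subset_range _ _)
      (mem_span_X_pow_image_of_X_mul_mem (by simp) hmul)

/-- If the entries of `A *ᵥ X` generate an ideal containing powers of all the variables, then that
ideal does not contain `det A`. -/
theorem det_notMem_span_mulVec_X (A : Matrix ι ι (MvPolynomial ι k)) (N : ℕ)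
    (hN : ∀ i, (X i : MvPolynomial ι k) ^ (N + 1) ∈ Ideal.span (Set.range (A.mulVec X))) :
    A.det ∉ Ideal.span (Set.range (A.mulVec X)) := by
  intro hdet
  choose B hB using fun i => Ideal.mem_span_range_iff_exists_fun.mp (hN i)
  have hBA : (Matrix.of B).mulVec (A.mulVec X) = fun i => X i ^ (N + 1) := _root_.funext hB
  have hmem := (Matrix.of B).det_mul_mem_span_mulVec_of_mem _ hdet
  rw [hBA, ← Matrix.det_mul] at hmem
  rw [Matrix.mulVec_mulVec] at hBA
  have hsub := det_sub_det_mem_span_X_pow _ (Matrix.diagonal fun i => X i ^ N) hBA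
    (by ext1 i; rw [Matrix.mulVec_diagonal, pow_succ])
  have hdiag := Ideal.sub_mem _ hmem hsub
  rw [sub_sub_cancel, Matrix.det_diagonal] at hdiag
  exact prod_X_pow_notMem_span_X_pow N hdiag

end Determinant
end MvPolynomial

section Duality

variable {k M : Type*} [Field k] [CommRing M] [Algebra k M]

/-- Contraction of the first factor of `β : M ⊗[k] M` against linear functionals. -/
noncomputable def dualContract (β : M ⊗[k] M) : Module.Dual k M →ₗ[k] M :=
  (TensorProduct.lid k M).toLinearMap ∘ₗ (LinearMap.rTensorHom M).flip β

theorem dualContract_apply (β : M ⊗[k] M) (φ : Module.Dual k M) :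
    dualContract β φ = TensorProduct.lid k M (φ.rTensor M β) := rfl

theorem dualContract_one_tmul_mul (β : M ⊗[k] M) (φ : Module.Dual k M) (x : M) :
    dualContract ((1 ⊗ₜ x) * β) φ = x * dualContract β φ := by
  simp only [dualContract_apply]
  induction β using TensorProduct.induction_on with
  | zero => simp
  | tmul a b => simp [Algebra.TensorProduct.tmul_mul_tmul]
  | add s t hs ht => simp only [mul_add, map_add, hs, ht]

theorem dualContract_tmul_one_mul (β : M ⊗[k] M) (φ : Module.Dual k M) (x : M) :
    dualContract ((x ⊗ₜ 1) * β) φ = dualContract β (φ ∘ₗ LinearMap.mulLeft k x) := by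
  simp only [dualContract_apply]
  induction β using TensorProduct.induction_on with
  | zero => simp
  | tmul a b => simp [Algebra.TensorProduct.tmul_mul_tmul]
  | add s t hs ht => simp only [mul_add, map_add, hs, ht]

theorem dualContract_algHom (β : M ⊗[k] M) (ε : M →ₐ[k] k) :
    dualContract β ε.toLinearMap =
      Algebra.TensorProduct.lift ((Algebra.ofId k M).comp ε) (AlgHom.id k M)
        (fun _ _ => Commute.all _ _) β := by
  simp only [dualContract_apply]
  induction β using TensorProduct.induction_on with
  | zero => simp
  | tmul a b => simp [Algebra.ofId_apply, Algebra.smul_def]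
  | add s t hs ht => simp only [map_add, hs, ht]

variable {β : M ⊗[k] M} {ε : M →ₐ[k] k}

theorem dualContract_comp_mulLeft (hβ : ∀ x : M, (x ⊗ₜ[k] 1) * β = (1 ⊗ₜ[k] x) * β)
    (φ : Module.Dual k M) (x : M) :
    dualContract β (φ ∘ₗ LinearMap.mulLeft k x) = x * dualContract β φ := by
  rw [← dualContract_tmul_one_mul, hβ, dualContract_one_tmul_mul]

theorem eq_smul_of_vanish_on_ker {φ : Module.Dual k M} (hφ : ∀ x ∈ RingHom.ker ε, φ x = 0) :
    φ = φ 1 • ε.toLinearMap := by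
  ext x
  have h := hφ (x - algebraMap k M (ε x)) (by simp [RingHom.mem_ker])
  rw [map_sub, sub_eq_zero] at h
  rw [h, Algebra.algebraMap_eq_smul_one]
  simp [mul_comm]

/-- If the augmentation ideal is nilpotent, contraction against `β` is injective as soon as it does
not kill the augmentation. -/
theorem dualContract_injective (hβ : ∀ x : M, (x ⊗ₜ[k] 1) * β = (1 ⊗ₜ[k] x) * β)
    (hnil : IsNilpotent (RingHom.ker ε))
    (hε : dualContract β ε.toLinearMap ≠ 0) : Function.Injective (dualContract β) := by
  obtain ⟨r, hr⟩ := hnil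
  have key : ∀ r : ℕ, ∀ φ : Module.Dual k M, dualContract β φ = 0 →
      (∀ x ∈ RingHom.ker ε ^ r, φ x = 0) → φ = 0 := by
    intro r
    induction r with
    | zero =>
      intro φ _ hφ
      ext x
      exact hφ x (by simp)
    | succ r ih =>
      intro φ h0 hφ
      have hker : ∀ x ∈ RingHom.ker ε, φ x = 0 := by
        intro x hx
        have : φ ∘ₗ LinearMap.mulLeft k x = 0 := by
          refine ih _ (by rw [dualContract_comp_mulLeft hβ, h0, mul_zero]) fun y hy => ?_
          refine hφ _ ?_
          rw [pow_succ']
          exact Ideal.mul_mem_mul hx hy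
        simpa using LinearMap.congr_fun this 1
      have hφ1 := eq_smul_of_vanish_on_ker hker
      rw [hφ1, map_smul, smul_eq_zero, or_iff_left hε] at h0
      rw [hφ1, h0, zero_smul]
  rw [injective_iff_map_eq_zero]
  intro φ h0
  refine key r φ h0 fun x hx => ?_
  rw [hr] at hx
  rw [(Ideal.mem_bot.mp hx : x = 0), map_zero]

/-- The socle of a finite-dimensional local algebra with a Bezoutian element is spanned by the
contraction of that element against the augmentation. -/
theorem exists_eq_smul_dualContract [Module.Finite k M]
    (hβ : ∀ x : M, (x ⊗ₜ[k] 1) * β = (1 ⊗ₜ[k] x) * β) (hnil : IsNilpotent (RingHom.ker ε))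
    (hε : dualContract β ε.toLinearMap ≠ 0) {u : M} (hu : ∀ x ∈ RingHom.ker ε, u * x = 0) :
    ∃ c : k, u = c • dualContract β ε.toLinearMap := by
  have hinj := dualContract_injective hβ hnil hε
  obtain ⟨φ, rfl⟩ := (LinearMap.injective_iff_surjective_of_finrank_eq_finrank
    Subspace.dual_finrank_eq).mp hinj u
  refine ⟨φ 1, ?_⟩
  rw [← map_smul, ← eq_smul_of_vanish_on_ker]
  intro x hx
  have : φ ∘ₗ LinearMap.mulLeft k x = 0 := hinj (by
    rw [dualContract_comp_mulLeft hβ, mul_comm, hu x hx, map_zero])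
  simpa using LinearMap.congr_fun this 1

end Duality

namespace MvPolynomial

variable {ι k : Type*} [Field k]

theorem tmul_one_sub_one_tmul_mem_span (p : MvPolynomial ι k) :
    p ⊗ₜ[k] (1 : MvPolynomial ι k) - 1 ⊗ₜ[k] p ∈ Ideal.span (Set.range fun i : ι =>
      (X i : MvPolynomial ι k) ⊗ₜ[k] (1 : MvPolynomial ι k) - 1 ⊗ₜ[k] X i) := by
  induction p using MvPolynomial.induction_on with
  | C a =>
    rw [← algebraMap_eq, Algebra.algebraMap_eq_smul_one, TensorProduct.smul_tmul, sub_self]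
    exact Ideal.zero_mem _
  | add p q hp hq =>
    rw [TensorProduct.add_tmul, TensorProduct.tmul_add, add_sub_add_comm]
    exact Ideal.add_mem _ hp hq
  | mul_X p i hp =>
    have : (p * X i) ⊗ₜ[k] (1 : MvPolynomial ι k) - 1 ⊗ₜ[k] (p * X i) =
        (X i ⊗ₜ 1) * (p ⊗ₜ[k] (1 : MvPolynomial ι k) - 1 ⊗ₜ[k] p) +
        (1 ⊗ₜ p) * ((X i : MvPolynomial ι k) ⊗ₜ[k] (1 : MvPolynomial ι k) - 1 ⊗ₜ[k] X i) := by
      simp only [mul_sub, Algebra.TensorProduct.tmul_mul_tmul, one_mul, mul_one, mul_comm p]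
      ring
    rw [this]
    exact Ideal.add_mem _ (Ideal.mul_mem_left _ _ hp)
      (Ideal.mul_mem_left _ _ (Ideal.subset_span ⟨i, rfl⟩))

theorem sub_C_constantCoeff_mem_span_X (p : MvPolynomial ι k) :
    p - C (constantCoeff p) ∈ Ideal.span (Set.range (X : ι → MvPolynomial ι k)) := by
  induction p using MvPolynomial.induction_on with
  | C a => simp
  | add p q hp hq =>
    rw [map_add, map_add, add_sub_add_comm]
    exact Ideal.add_mem _ hp hq
  | mul_X p i _ =>
    rw [map_mul, constantCoeff_X, mul_zero, C_0, sub_zero]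
    exact Ideal.mul_mem_left _ _ (Ideal.subset_span ⟨i, rfl⟩)

theorem finite_quotient_of_X_pow_mem [Finite ι] {I : Ideal (MvPolynomial ι k)} {N : ℕ}
    (hN : ∀ i, X i ^ (N + 1) ∈ I) : Module.Finite k (MvPolynomial ι k ⧸ I) := by
  have : Algebra.IsIntegral k (MvPolynomial ι k ⧸ I) := by
    refine ⟨fun x => ?_⟩
    obtain ⟨p, rfl⟩ := Ideal.Quotient.mk_surjective x
    induction p using MvPolynomial.induction_on with
    | C a => exact isIntegral_algebraMap
    | add p q hp hq => rw [map_add]; exact hp.add hq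
    | mul_X p i hp =>
      rw [map_mul]
      refine hp.mul (IsIntegral.of_pow N.succ_pos ?_)
      rw [← map_pow, Ideal.Quotient.eq_zero_iff_mem.mpr (hN i)]
      exact isIntegral_zero
  exact Algebra.IsIntegral.finite

end MvPolynomial
namespace MvPolynomial

section Socle

variable {ι k : Type*} [Fintype ι] [DecidableEq ι] [Field k]

/-- The Bezoutian of a tuple `g` of polynomials vanishing at the origin: an element of the enveloping
algebra of a quotient in which `g` vanishes that is killed by the diagonal ideal, and whose
restriction to the origin in the first factor is the determinant of a matrix sending the variables
to `g`. -/
theorem exists_bezoutian {M : Type*} [CommRing M] [Algebra k M] {π : MvPolynomial ι k →ₐ[k] M}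
    (hπ : Function.Surjective π) {g : ι → MvPolynomial ι k}
    (hg : ∀ i, π (g i) = 0) (hg0 : ∀ i, constantCoeff (g i) = 0)
    {ε : M →ₐ[k] k} (hε : ∀ i, ε (π (X i)) = 0) :
    ∃ (β : M ⊗[k] M) (A : Matrix ι ι (MvPolynomial ι k)),
      (∀ x, (x ⊗ₜ[k] 1) * β = (1 ⊗ₜ[k] x) * β) ∧ A.mulVec X = g ∧
        dualContract β ε.toLinearMap = π A.det := by
  choose B hB using fun i => Ideal.mem_span_range_iff_exists_fun.mp
    (tmul_one_sub_one_tmul_mem_span (g i))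
  let Ψ := Algebra.TensorProduct.map π π
  have hΨ (p q : MvPolynomial ι k) : Ψ (p ⊗ₜ[k] q) = π p ⊗ₜ[k] π q := rfl
  let ρ : MvPolynomial ι k ⊗[k] MvPolynomial ι k →ₐ[k] MvPolynomial ι k :=
    Algebra.TensorProduct.lift ((Algebra.ofId k _).comp (aeval 0)) (AlgHom.id k _)
      fun _ _ => Commute.all _ _
  have hb : ((Matrix.of B).map Ψ).mulVec (fun i => π (X i) ⊗ₜ[k] 1 - 1 ⊗ₜ[k] π (X i)) = 0 := by
    ext1 i
    have h := congrArg Ψ (hB i)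
    simpa [hΨ, hg, Matrix.mulVec, dotProduct] using h
  refine ⟨((Matrix.of B).map Ψ).det, (Matrix.of B).map ρ, fun x => ?_, ?_, ?_⟩
  · obtain ⟨p, rfl⟩ := hπ x
    obtain ⟨c, hc⟩ := Ideal.mem_span_range_iff_exists_fun.mp (tmul_one_sub_one_tmul_mem_span p)
    have hp := congrArg Ψ hc
    simp only [map_sum, map_mul, map_sub, hΨ, map_one] at hp
    rw [← sub_eq_zero, ← sub_mul, ← hp, Finset.sum_mul]
    refine Finset.sum_eq_zero fun i _ => ?_
    have h := ((Matrix.of B).map Ψ).det_mul_eq_sum_adjugate_mul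
      (fun i => π (X i) ⊗ₜ[k] 1 - 1 ⊗ₜ[k] π (X i)) i
    rw [hb] at h
    rw [mul_assoc, mul_comm _ (Matrix.det _), h]
    simp
  · ext1 i
    have h := congrArg ρ (hB i)
    simpa [ρ, hg0, Matrix.mulVec, dotProduct] using h
  · have hcomp : (Algebra.TensorProduct.lift ((Algebra.ofId k M).comp ε) (AlgHom.id k M)
        fun _ _ => Commute.all _ _).comp Ψ = π.comp ρ := by
      ext i
      · simp [hΨ, ρ, hε]
      · simp [hΨ, ρ]
    rw [dualContract_algHom, ← AlgHom.mapMatrix_apply, ← AlgHom.map_det, ← AlgHom.comp_apply,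
      hcomp, AlgHom.comp_apply, AlgHom.map_det ρ, AlgHom.mapMatrix_apply]

/-- If the entries of `A *ᵥ X` generate an ideal `I` containing powers of all the variables, then
the elements of `k[X] ⧸ I` killed by the variables are the multiples of the class of `det A`. -/
theorem mul_X_eq_zero_iff_exists_eq_smul_det {I : Ideal (MvPolynomial ι k)}
    (A : Matrix ι ι (MvPolynomial ι k)) (hA : Ideal.span (Set.range (A.mulVec X)) = I) {N : ℕ}
    (hN : ∀ i, X i ^ (N + 1) ∈ I) (u : MvPolynomial ι k ⧸ I) :
    (∀ i, u * Ideal.Quotient.mk I (X i) = 0) ↔ ∃ c : k, u = c • Ideal.Quotient.mk I A.det := by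
  have hdetX (B : Matrix ι ι (MvPolynomial ι k)) (hB : Ideal.span (Set.range (B.mulVec X)) = I)
      (i : ι) : Ideal.Quotient.mk I B.det * Ideal.Quotient.mk I (X i) = 0 := by
    rw [← map_mul, Ideal.Quotient.eq_zero_iff_mem, ← hB]
    exact B.det_mul_mem_span_mulVec X i
  have hdet (B : Matrix ι ι (MvPolynomial ι k)) (hB : Ideal.span (Set.range (B.mulVec X)) = I) :
      Ideal.Quotient.mk I B.det ≠ 0 := by
    rw [Ne, Ideal.Quotient.eq_zero_iff_mem, ← hB]
    exact det_notMem_span_mulVec_X B N (hB ▸ hN)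
  have := finite_quotient_of_X_pow_mem hN
  have hg0 (i : ι) : constantCoeff (A.mulVec X i) = 0 := by
    simp [Matrix.mulVec, dotProduct]
  let ε : (MvPolynomial ι k ⧸ I) →ₐ[k] k := Ideal.Quotient.liftₐ I (aeval 0) (by
    intro a ha
    rw [← hA] at ha
    have hle : Ideal.span (Set.range (A.mulVec X)) ≤ RingHom.ker (aeval (0 : ι → k)) := by
      rw [Ideal.span_le]
      rintro _ ⟨i, rfl⟩
      simpa [RingHom.mem_ker, aeval_zero] using hg0 i
    exact hle ha)
  have hεX (i : ι) : ε (Ideal.Quotient.mk I (X i)) = 0 := by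
    change aeval (0 : ι → k) (X i) = 0
    simp
  have hker : RingHom.ker ε = Ideal.span (Set.range fun i => Ideal.Quotient.mk I (X i)) := by
    refine le_antisymm (fun x hx => ?_) ?_
    · obtain ⟨p, rfl⟩ := Ideal.Quotient.mk_surjective x
      have hp : p ∈ RingHom.ker (constantCoeff (σ := ι) (R := k)) := by
        change aeval (0 : ι → k) p = 0 at hx
        simpa [RingHom.mem_ker, aeval_zero] using hx
      have hmem := Ideal.mem_map_of_mem (Ideal.Quotient.mk I) (sub_C_constantCoeff_mem_span_X p)
      rw [RingHom.mem_ker.mp hp, C_0, sub_zero, Ideal.map_span, ← Set.range_comp] at hmem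
      exact hmem
    · rw [Ideal.span_le]
      rintro _ ⟨i, rfl⟩
      exact hεX i
  have hnil : IsNilpotent (RingHom.ker ε) := by
    rw [Ideal.FG.isNilpotent_iff_le_nilradical (IsNoetherian.noetherian _), hker, Ideal.span_le]
    rintro _ ⟨i, rfl⟩
    refine ⟨N + 1, ?_⟩
    rw [← map_pow]
    exact Ideal.Quotient.eq_zero_iff_mem.mpr (hN i)
  obtain ⟨β, B, hβ, hB, hβε⟩ := exists_bezoutian (Ideal.Quotient.mkₐ_surjective k I)
    (fun i => Ideal.Quotient.eq_zero_iff_mem.mpr (hA ▸ Ideal.subset_span ⟨i, rfl⟩)) hg0 hεX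
  rw [Ideal.Quotient.mkₐ_eq_mk] at hβε
  have hBI : Ideal.span (Set.range (B.mulVec X)) = I := by rw [hB, hA]
  have hsoc {v : MvPolynomial ι k ⧸ I} (hv : ∀ i, v * Ideal.Quotient.mk I (X i) = 0) :
      ∃ c : k, v = c • Ideal.Quotient.mk I B.det := by
    rw [← hβε]
    refine exists_eq_smul_dualContract hβ hnil (hβε ▸ hdet B hBI) fun x hx => ?_
    rw [hker] at hx
    have hle : Ideal.span (Set.range fun i => Ideal.Quotient.mk I (X i)) ≤
        Submodule.annihilator (Ideal.span {v}) := by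
      rw [Ideal.span_le]
      rintro _ ⟨i, rfl⟩
      rw [SetLike.mem_coe, Submodule.mem_annihilator_span_singleton, smul_eq_mul, mul_comm, hv]
    rw [mul_comm]
    exact (Submodule.mem_annihilator_span_singleton _ _).mp (hle hx)
  constructor
  · intro hu
    obtain ⟨a, ha⟩ := hsoc (hdetX A hA)
    obtain ⟨c, rfl⟩ := hsoc hu
    have ha0 : a ≠ 0 := by
      rintro rfl
      exact hdet A hA (by rw [ha, zero_smul])
    exact ⟨c * a⁻¹, by rw [ha, smul_smul, inv_mul_cancel_right₀ ha0]⟩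
  · rintro ⟨c, rfl⟩ i
    rw [smul_mul_assoc, hdetX A hA, smul_zero]

end Socle

theorem exists_X_pow_mem_of_zeroLocus {ι : Type*} [Finite ι] {k : Type*} [Field k] [IsAlgClosed k]
    {g : ι → MvPolynomial ι k} (hg : ∀ p : ι → k, (∀ i, eval p (g i) = 0) → p = 0) :
    ∃ N : ℕ, ∀ i, X i ^ (N + 1) ∈ Ideal.span (Set.range g) := by
  have hrad (i : ι) : X i ∈ (Ideal.span (Set.range g)).radical := by
    rw [← vanishingIdeal_zeroLocus_eq_radical (K := k), mem_vanishingIdeal_iff]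
    intro x hx
    rw [hg x fun j => hx _ (Ideal.subset_span ⟨j, rfl⟩)]
    simp
  choose m hm using hrad
  cases nonempty_fintype ι
  exact ⟨∑ i, m i, fun i => Ideal.pow_mem_of_pow_mem _ (hm i)
    ((Finset.single_le_sum (fun _ _ => Nat.zero_le _) (Finset.mem_univ i)).trans (Nat.le_succ _))⟩

end MvPolynomial

/-- For `n ≥ 2`, `d ≥ 3` and a nondegenerate form `f` of degree `d`,
the socle of the Milnor algebra `M_f = ℂ[z]/(f_{z_1},…,f_{z_n})` is the one-dimensional space
spanned by the class of the Hessian `Hess f = det (∂²f/∂z_i∂z_j)`;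
in particular `Hess f ∉ (f_{z_1},…,f_{z_n})`. -/
theorem socle_of_milnor_algebra_eq_span_hessian
    (n d : ℕ) (hn : 2 ≤ n) (hd : 3 ≤ d)
    (f : MvPolynomial (Fin n) ℂ)
    (hf : f.IsHomogeneous d)
    (hnd : ∀ p : Fin n → ℂ, (∀ i, eval p (pderiv i f) = 0) → p = 0) :
    letI I : Ideal (MvPolynomial (Fin n) ℂ) := Ideal.span (Set.range fun i => pderiv i f)
    letI hessPoly : MvPolynomial (Fin n) ℂ :=
      Matrix.det (Matrix.of fun i j : Fin n => pderiv i (pderiv j f))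
    letI h : MvPolynomial (Fin n) ℂ ⧸ I := Ideal.Quotient.mk I hessPoly
    letI m : Ideal (MvPolynomial (Fin n) ℂ ⧸ I) :=
      Ideal.span (Set.range fun i => Ideal.Quotient.mk I (X i))
    ({x : MvPolynomial (Fin n) ℂ ⧸ I | ∀ y ∈ m, x * y = 0}
        = {x : MvPolynomial (Fin n) ℂ ⧸ I | ∃ c : ℂ, x = c • h})
      ∧ h ≠ 0 ∧ hessPoly ∉ I := by
  set I : Ideal (MvPolynomial (Fin n) ℂ) := Ideal.span (Set.range fun i => pderiv i f)
  set hessPoly : MvPolynomial (Fin n) ℂ :=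
    Matrix.det (Matrix.of fun i j : Fin n => pderiv i (pderiv j f))
  obtain ⟨N, hN⟩ := exists_X_pow_mem_of_zeroLocus hnd
  let A : Matrix (Fin n) (Fin n) (MvPolynomial (Fin n) ℂ) :=
    Matrix.of fun i j => pderiv j (pderiv i f)
  have hdet : A.det = hessPoly := Matrix.det_transpose _
  have hd0 : ((d - 1 : ℕ) : ℂ) ≠ 0 := Nat.cast_ne_zero.mpr (by omega)
  have hAX (i : Fin n) : A.mulVec X i = C ((d - 1 : ℕ) : ℂ) * pderiv i f := by
    have := (hf.pderiv (i := i)).sum_X_mul_pderiv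
    simpa [A, Matrix.mulVec, dotProduct, mul_comm] using this
  have hA : Ideal.span (Set.range (A.mulVec X)) = I := by
    refine le_antisymm ?_ ?_ <;> rw [Ideal.span_le] <;> rintro _ ⟨i, rfl⟩
    · rw [hAX]
      exact Ideal.mul_mem_left _ _ (Ideal.subset_span ⟨i, rfl⟩)
    · have : pderiv i f = C ((d - 1 : ℕ) : ℂ)⁻¹ * A.mulVec X i := by
        rw [hAX, ← mul_assoc, ← C_mul, inv_mul_cancel₀ hd0, C_1, one_mul]
      change pderiv i f ∈ _
      rw [this]
      exact Ideal.mul_mem_left _ _ (Ideal.subset_span ⟨i, rfl⟩)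
  have hmem : hessPoly ∉ I := by
    rw [← hdet, ← hA]
    exact det_notMem_span_mulVec_X A N (hA ▸ hN)
  refine ⟨?_, fun h0 => hmem (Ideal.Quotient.eq_zero_iff_mem.mp h0), hmem⟩
  ext u
  rw [Set.mem_ofPred_eq, Set.mem_ofPred_eq, ← hdet,
    ← mul_X_eq_zero_iff_exists_eq_smul_det A hA hN u]
  refine ⟨fun hu i => hu _ (Ideal.subset_span ⟨i, rfl⟩), fun hu y hy => ?_⟩
  induction hy using Submodule.span_induction with
  | mem _ hx => obtain ⟨i, rfl⟩ := hx; exact hu i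
  | zero => exact mul_zero u
  | add x y _ _ hx hy => rw [mul_add, hx, hy, add_zero]
  | smul a x _ hx => rw [smul_eq_mul, mul_left_comm, hx, mul_zero]
end

section
/- Let n ≥ 2, d ≥ 3, let 𝔣 = (f_1,…,f_n) be an n-tuple of homogeneous forms of degree d−1 in ℂ[z_1,…,z_n] whose only common zero in ℂ^n is the origin, and let C_1, C_2 ∈ GL_n(ℂ). Define ((C_1,C_2)𝔣)(z) := 𝔣(zC_1^{−T})C_2^{−1} (row vector conventions). Then the forms constituting (C_1,C_2)𝔣 have no common zero other than the origin, and the associated form of (C_1,C_2)𝔣 equals det(C_1C_2) times the form e ↦ 𝐟(eC_1), where 𝐟 is the associated form of 𝔣. -/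
open MvPolynomial

noncomputable section

/-- The Jacobian `det (∂f_i/∂z_j)` of an `n`-tuple of forms. -/
def jacPoly (n : ℕ) (f : Fin n → MvPolynomial (Fin n) ℂ) : MvPolynomial (Fin n) ℂ :=
  Matrix.det (Matrix.of fun i j : Fin n => pderiv j (f i))

/-- `μ` is the system of coefficients defining the associated form of the tuple `𝔣`:
for each multi-index `m` with `|m| = n(d-2)`, the scalar `μ m` satisfies
`z^m - μ m · Jac 𝔣 ∈ (f_1,…,f_n)`. -/
def IsAssocCoeffsT (n d : ℕ) (f : Fin n → MvPolynomial (Fin n) ℂ)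
    (μ : (Fin n → ℕ) → ℂ) : Prop :=
  ∀ m : Fin n → ℕ, (∑ i, m i) = n * (d - 2) →
    (∏ i, X i ^ m i) - C (μ m) * jacPoly n f ∈ Ideal.span (Set.range f)

/-- The associated form `Σ_{|m| = n(d-2)} (n(d-2))!/(m_1!⋯m_n!) · μ m · e^m`
built from the coefficients `μ`. -/
def assocForm (n d : ℕ) (μ : (Fin n → ℕ) → ℂ) : MvPolynomial (Fin n) ℂ :=
  ∑ m ∈ Finset.Nat.antidiagonalTuple n (n * (d - 2)),
    C ((Nat.multinomial Finset.univ m : ℂ) * μ m) * ∏ i, X i ^ m i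

end

theorem mem_span_X_pow_of_mul_X_pow_mem {σ K : Type*} [Field K] (a : ℕ) (s : Set σ) {k : σ}
    (hk : k ∉ s) {g : MvPolynomial σ K}
    (h : g * X k ^ a ∈ Ideal.span ((fun i => (X i ^ a : MvPolynomial σ K)) '' s)) :
    g ∈ Ideal.span ((fun i => (X i ^ a : MvPolynomial σ K)) '' s) := by
  classical
  have hs : (fun i => (X i ^ a : MvPolynomial σ K)) '' s =
      (fun m => monomial m (1 : K)) '' ((fun i => Finsupp.single i a) '' s) := by
    rw [Set.image_image]
    simp only [X_pow_eq_monomial]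
  rw [hs, mem_ideal_span_monomial_image] at h ⊢
  intro m hm
  obtain ⟨_, ⟨i, hi, rfl⟩, hle⟩ := h (m + Finsupp.single k a) (by
    rw [mem_support_iff, X_pow_eq_monomial, coeff_mul_monomial, mul_one]
    exact mem_support_iff.mp hm)
  have hik : k ≠ i := fun e => hk (e ▸ hi)
  refine ⟨_, ⟨i, hi, rfl⟩, ?_⟩
  rw [Finsupp.single_le_iff] at hle ⊢
  simpa [Finsupp.single_apply, hik] using hle

/-- `t` is a nonzerodivisor modulo a deformation `x_i ^ a + t * f_i` of the powers `x_i ^ a`. -/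
theorem mem_span_deformation_of_X_mul_mem {σ K : Type*} [Field K] (a : ℕ)
    (f : σ → MvPolynomial σ K) (s : Finset σ) {u : Polynomial (MvPolynomial σ K)}
    (h : Polynomial.X * u ∈ Ideal.span
      ((fun i => Polynomial.C (X i ^ a) + Polynomial.X * Polynomial.C (f i)) '' (s : Set σ))) :
    u ∈ Ideal.span
      ((fun i => Polynomial.C (X i ^ a) + Polynomial.X * Polynomial.C (f i)) '' (s : Set σ)) := by
  classical
  induction s using Finset.induction_on generalizing u with
  | empty => simpa using h
  | insert k s hk ih =>
    set F : σ → Polynomial (MvPolynomial σ K) :=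
      fun i => Polynomial.C (X i ^ a) + Polynomial.X * Polynomial.C (f i) with hF
    have hmap : (Ideal.span (F '' (s : Set σ))).map (Polynomial.evalRingHom 0) =
        Ideal.span ((fun i => (X i ^ a : MvPolynomial σ K)) '' (s : Set σ)) := by
      rw [Ideal.map_span, Set.image_image]
      simp [hF]
    have hsurj : Function.Surjective (Polynomial.evalRingHom (0 : MvPolynomial σ K)) :=
      fun r => ⟨Polynomial.C r, by simp⟩
    rw [Finset.coe_insert, Set.image_insert_eq, Ideal.mem_span_insert] at h ⊢
    obtain ⟨b, v, hv, huv⟩ := h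
    have hb : b.eval 0 ∈ Ideal.span ((fun i => (X i ^ a : MvPolynomial σ K)) '' (s : Set σ)) := by
      apply mem_span_X_pow_of_mul_X_pow_mem a _ (k := k) (by simpa using hk)
      have hv' := Ideal.mem_map_of_mem (Polynomial.evalRingHom 0) hv
      rw [hmap] at hv'
      have := congrArg (Polynomial.eval 0) huv
      simp [hF] at this
      rw [eq_neg_of_add_eq_zero_left this.symm]
      exact neg_mem hv'
    rw [← hmap, Ideal.mem_map_iff_of_surjective _ hsurj] at hb
    obtain ⟨w, hw, hwb⟩ := hb
    obtain ⟨b', hb'⟩ : Polynomial.X ∣ b - w := by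
      rw [Polynomial.X_dvd_iff, Polynomial.coeff_zero_eq_eval_zero, Polynomial.eval_sub]
      simpa [sub_eq_zero] using hwb.symm
    refine ⟨b', u - b' * F k, ih ?_, by ring⟩
    have : Polynomial.X * (u - b' * F k) = w * F k + v := by
      linear_combination huv + F k * hb'
    rw [this]
    exact add_mem (Ideal.mul_mem_right _ _ hw) hv

theorem homogeneousComponent_mul_of_isHomogeneous_right {σ K : Type*} [CommSemiring K]
    {f : MvPolynomial σ K} {a : ℕ} (hf : f.IsHomogeneous a) (g : MvPolynomial σ K) (k : ℕ) :
    homogeneousComponent (k + a) (g * f) = homogeneousComponent k g * f := by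
  classical
  have h : ∀ i, homogeneousComponent (k + a) (homogeneousComponent i g * f) =
      if i = k then homogeneousComponent k g * f else 0 := fun i => by
    rw [homogeneousComponent_of_mem ((homogeneousComponent_isHomogeneous i g).mul hf)]
    by_cases hik : i = k
    · subst hik; simp
    · rw [if_neg hik, if_neg (by omega)]
  conv_lhs => rw [← sum_homogeneousComponent g, Finset.sum_mul, map_sum]
  simp only [h, Finset.sum_ite_eq', Finset.mem_range]
  split_ifs with hk
  · rfl
  · rw [homogeneousComponent_eq_zero _ _ (by omega), zero_mul]

theorem det_mul_mem_of_mulVec_mem {ι R : Type*} [CommRing R] [Fintype ι] [DecidableEq ι]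
    {I : Ideal R} {M : Matrix ι ι R} {v : ι → R} (h : ∀ i, M.mulVec v i ∈ I) (i : ι) :
    M.det * v i ∈ I := by
  have hadj : M.adjugate.mulVec (M.mulVec v) i = M.det * v i := by
    rw [Matrix.mulVec_mulVec, Matrix.adjugate_mul, Matrix.smul_mulVec, Matrix.one_mulVec,
      Pi.smul_apply, smul_eq_mul]
  rw [← hadj]
  exact sum_mem fun k _ => Ideal.mul_mem_left _ _ (h k)

theorem MvPolynomial.IsHomogeneous.eq_sum_finsuppAntidiag {σ K : Type*} [Fintype σ] [DecidableEq σ]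
    [CommSemiring K] {q : MvPolynomial σ K} {N : ℕ} (hq : q.IsHomogeneous N) :
    q = ∑ m : (Finset.univ : Finset σ).finsuppAntidiag N, C (q.coeff m) * monomial m.1 1 := by
  rw [Finset.sum_coe_sort _ (fun m => C (q.coeff m) * monomial m 1)]
  conv_lhs => rw [q.as_sum]
  rw [Finset.sum_subset (s₂ := (Finset.univ : Finset σ).finsuppAntidiag N)]
  · simp [C_mul_monomial]
  · intro m hm
    rw [Finset.mem_finsuppAntidiag]
    refine ⟨?_, Finset.subset_univ _⟩
    rw [← hq (mem_support_iff.mp hm), Finsupp.weight_apply, Finsupp.sum_fintype] <;> simp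
  · intro m _ hm
    simp [notMem_support_iff.mp hm]

/-- If the degree `a` forms `f_i` generate all forms of degree `N ≥ a`, then modulo the deformation
`x_i ^ a + t * f_i` all these forms are annihilated by a monic polynomial in `t`. -/
theorem exists_monic_mul_mem_span_deformation {σ K : Type*} [Fintype σ] [Field K] {a N : ℕ}
    (f : σ → MvPolynomial σ K) (hf : ∀ i, (f i).IsHomogeneous a) (haN : a ≤ N)
    (hall : ∀ m : σ →₀ ℕ, ∑ i, m i = N → monomial m (1 : K) ∈ Ideal.span (Set.range f)) :
    ∃ p : Polynomial K, p.Monic ∧ ∀ m : σ →₀ ℕ, ∑ i, m i = N →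
      p.map C * Polynomial.C (monomial m (1 : K)) ∈ Ideal.span (Set.range fun i =>
        Polynomial.C (X i ^ a) + Polynomial.X * Polynomial.C (f i)) := by
  classical
  obtain ⟨k, rfl⟩ := Nat.exists_eq_add_of_le' haN
  set ι := (Finset.univ : Finset σ).finsuppAntidiag (k + a)
  have hι : ∀ m : ι, ∑ i, m.1 i = k + a := fun m => (Finset.mem_finsuppAntidiag.mp m.2).1
  have hex : ∀ m : ι, ∃ g : σ → MvPolynomial σ K, (∀ i, (g i).IsHomogeneous k) ∧
      monomial m.1 1 = ∑ i, g i * f i := fun m => by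
    obtain ⟨c, hc⟩ := Ideal.mem_span_range_iff_exists_fun.mp (hall m (hι m))
    refine ⟨fun i => homogeneousComponent k (c i),
      fun i => homogeneousComponent_isHomogeneous _ _, ?_⟩
    simp only [← homogeneousComponent_mul_of_isHomogeneous_right (hf _)]
    rw [← map_sum, hc, homogeneousComponent_eq_self]
    refine isHomogeneous_monomial _ ?_
    rw [← hι m, Finsupp.degree_eq_sum]
  choose g hg hgm using hex
  obtain ⟨B, hB⟩ : ∃ B : Matrix ι ι K, ∀ m : ι,
      ∑ i, g m i * X i ^ a = ∑ m' : ι, C (B m m') * monomial m'.1 1 := by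
    refine ⟨fun m m' => (∑ i, g m i * X i ^ a).coeff m'.1, fun m => ?_⟩
    refine IsHomogeneous.eq_sum_finsuppAntidiag (IsHomogeneous.sum _ _ _ fun i _ => ?_)
    exact (hg m i).mul (by simpa using (isHomogeneous_X K i).pow a)
  refine ⟨(-B).charpoly, (-B).charpoly_monic, fun m hm => ?_⟩
  have hdet : (-B).charpoly.map C =
      ((Polynomial.mapRingHom (C : K →+* MvPolynomial σ K)).mapMatrix (-B).charmatrix).det := by
    rw [Matrix.charpoly, ← RingHom.map_det, Polynomial.coe_mapRingHom]
  rw [hdet]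
  refine det_mul_mem_of_mulVec_mem (v := fun m : ι => Polynomial.C (monomial m.1 (1 : K)))
    (fun m => ?_) ⟨m, Finset.mem_finsuppAntidiag.mpr ⟨hm, Finset.subset_univ _⟩⟩
  have hentry : ∀ m', ((-B).charmatrix m m').map (C : K →+* MvPolynomial σ K) =
      (if m = m' then Polynomial.X else 0) + Polynomial.C (C (B m m')) := fun m' => by
    by_cases h : m = m'
    · subst h; simp
    · simp [h]
  have hsum : ∑ m', ((-B).charmatrix m m').map C * Polynomial.C (monomial m'.1 (1 : K)) =
      ∑ i, Polynomial.C (g m i) * (Polynomial.C (X i ^ a) + Polynomial.X * Polynomial.C (f i)) := by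
    have hX : ∑ i, Polynomial.C (g m i) * (Polynomial.X * Polynomial.C (f i)) =
        Polynomial.X * Polynomial.C (monomial m.1 1) := by
      rw [hgm m, map_sum, Finset.mul_sum]
      exact Finset.sum_congr rfl fun i _ => by rw [map_mul]; ring
    have hC : ∑ i, Polynomial.C (g m i) * Polynomial.C (X i ^ a) =
        ∑ m', Polynomial.C (C (B m m')) * Polynomial.C (monomial m'.1 (1 : K)) := by
      simpa only [map_sum, map_mul] using congrArg Polynomial.C (hB m)
    simp only [mul_add, Finset.sum_add_distrib]
    rw [hX, hC, add_comm]
    simp only [hentry, add_mul, Finset.sum_add_distrib, ite_mul, zero_mul, Finset.sum_ite_eq,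
      Finset.mem_univ, if_true]
  change ∑ m', ((-B).charmatrix m m').map C * Polynomial.C (monomial m'.1 (1 : K)) ∈ _
  rw [hsum]
  exact sum_mem fun i _ => Ideal.mul_mem_left _ _ (Ideal.subset_span (Set.mem_range_self i))

/-- Some monomial of degree `|σ| (a - 1)` avoids any ideal generated by a family, indexed by the
variables, of forms of degree `a`. -/
theorem exists_monomial_notMem_span {σ K : Type*} [Fintype σ] [Field K] {a : ℕ} (ha : 0 < a)
    (f : σ → MvPolynomial σ K) (hf : ∀ i, (f i).IsHomogeneous a)
    (haN : a ≤ Fintype.card σ * (a - 1)) :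
    ∃ m : σ →₀ ℕ, ∑ i, m i = Fintype.card σ * (a - 1) ∧
      monomial m (1 : K) ∉ Ideal.span (Set.range f) := by
  by_contra! hall
  obtain ⟨p, hp, hann⟩ := exists_monic_mul_mem_span_deformation f hf haN hall
  set F : σ → Polynomial (MvPolynomial σ K) :=
    fun i => Polynomial.C (X i ^ a) + Polynomial.X * Polynomial.C (f i)
  let w : σ →₀ ℕ := Finsupp.equivFunOnFinite.symm fun _ => a - 1
  have hw : ∑ i, w i = Fintype.card σ * (a - 1) := by simp [w]
  obtain ⟨q, hq, hq0⟩ := Polynomial.exists_eq_pow_rootMultiplicity_mul_and_not_dvd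
    p hp.ne_zero 0
  have hstrip : ∀ (j : ℕ) (u : Polynomial (MvPolynomial σ K)),
      Polynomial.X ^ j * u ∈ Ideal.span (Set.range F) → u ∈ Ideal.span (Set.range F) := by
    intro j u
    induction j with
    | zero => simp
    | succ j ih =>
      intro h
      apply ih
      have := mem_span_deformation_of_X_mul_mem a f Finset.univ
        (u := Polynomial.X ^ j * u) (by
          rw [← mul_assoc, ← pow_succ', Finset.coe_univ, Set.image_univ]; exact h)
      rwa [Finset.coe_univ, Set.image_univ] at this
  have hmem : q.map C * Polynomial.C (monomial w 1) ∈ Ideal.span (Set.range F) := by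
    have := hann w hw
    rw [hq] at this
    apply hstrip (p.rootMultiplicity 0)
    simpa [mul_assoc] using this
  have hmem0 := Ideal.mem_map_of_mem (Polynomial.evalRingHom 0) hmem
  have hset : Polynomial.evalRingHom 0 '' Set.range F =
      (fun m => monomial m (1 : K)) '' Set.range fun i : σ => Finsupp.single i a := by
    rw [← Set.range_comp, ← Set.range_comp]
    congr 1
    funext i
    simp [F, X_pow_eq_monomial]
  rw [Ideal.map_span, hset, mem_ideal_span_monomial_image] at hmem0
  have hq0' : q.coeff 0 ≠ 0 := fun h => hq0 (by simpa [Polynomial.X_dvd_iff] using h)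
  obtain ⟨_, ⟨i, rfl⟩, hi⟩ := hmem0 w (by
    classical
    simpa [Polynomial.eval_map, C_mul_monomial, coeff_monomial] using hq0')
  rw [Finsupp.single_le_iff] at hi
  simp [w] at hi
  omega

theorem pderiv_aeval_linear {σ K : Type*} [Fintype σ] [CommRing K]
    (A : Matrix σ σ K) (j : σ) (q : MvPolynomial σ K) :
    pderiv j (aeval (fun k => ∑ l, A k l • (X l : MvPolynomial σ K)) q) =
      ∑ k, aeval (fun k => ∑ l, A k l • (X l : MvPolynomial σ K)) (pderiv k q) * C (A k j) := by
  classical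
  set φ : MvPolynomial σ K →ₐ[K] MvPolynomial σ K :=
    aeval (fun k => ∑ l, A k l • (X l : MvPolynomial σ K)) with hφ
  induction q using MvPolynomial.induction_on with
  | C r => simp [hφ]
  | add p q hp hq => simp only [map_add, hp, hq, add_mul, Finset.sum_add_distrib]
  | mul_X p i hp =>
    have hX : pderiv j (φ (X i)) = C (A i j) := by
      simp only [hφ, aeval_X, map_sum, Derivation.map_smul, pderiv_X]
      simp [Pi.single_apply, smul_eq_C_mul]
    simp only [map_mul, Derivation.leibniz, hp, hX, map_add, smul_eq_mul, add_mul,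
      Finset.sum_add_distrib, pderiv_X]
    congr 1
    · simp [Pi.single_apply]
    · rw [Finset.mul_sum]
      exact Finset.sum_congr rfl fun k _ => by ring

theorem jacPoly_linear_change (n : ℕ) (f : Fin n → MvPolynomial (Fin n) ℂ)
    (A B : Matrix (Fin n) (Fin n) ℂ) :
    jacPoly n (fun i => ∑ j, B j i • aeval (fun k => ∑ l, A k l • X l) (f j)) =
      C (A.det * B.det) * aeval (fun k => ∑ l, A k l • X l) (jacPoly n f) := by
  set φ : MvPolynomial (Fin n) ℂ →ₐ[ℂ] MvPolynomial (Fin n) ℂ :=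
    aeval (fun k => ∑ l, A k l • X l) with hφ
  have h : (Matrix.of fun i j : Fin n => pderiv j (∑ j, B j i • φ (f j))) =
      (C.mapMatrix B).transpose *
        (φ.mapMatrix (Matrix.of fun i j : Fin n => pderiv j (f i)) * C.mapMatrix A) := by
    ext1 i j
    simp only [Matrix.of_apply, map_sum, Derivation.map_smul, hφ, pderiv_aeval_linear,
      Matrix.mul_apply, Matrix.transpose_apply, RingHom.mapMatrix_apply, AlgHom.mapMatrix_apply,
      Matrix.map_apply]
    exact Finset.sum_congr rfl fun k _ => smul_eq_C_mul _ _
  rw [jacPoly, jacPoly, h, Matrix.det_mul, Matrix.det_mul, Matrix.det_transpose,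
    ← RingHom.map_det, ← RingHom.map_det, ← AlgHom.map_det, map_mul]
  ring

theorem IsAssocCoeffsT.linear_pow_sub_mem {n d : ℕ} {f : Fin n → MvPolynomial (Fin n) ℂ}
    {μ : (Fin n → ℕ) → ℂ} (h : IsAssocCoeffsT n d f μ) (e : Fin n → ℂ) :
    (∑ i, C (e i) * X i) ^ (n * (d - 2)) - C (eval e (assocForm n d μ)) * jacPoly n f ∈
      Ideal.span (Set.range f) := by
  have hexp : (∑ i, C (e i) * X i) ^ (n * (d - 2)) -
      C (eval e (assocForm n d μ)) * jacPoly n f =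
      ∑ m ∈ Finset.Nat.antidiagonalTuple n (n * (d - 2)),
        C ((Nat.multinomial Finset.univ m : ℂ) * ∏ i, e i ^ m i) *
          ((∏ i, X i ^ m i) - C (μ m) * jacPoly n f) := by
    rw [Finset.sum_pow_eq_sum_piAntidiag, Finset.piAntidiag_univ_fin_eq_antidiagonalTuple,
      assocForm, map_sum, map_sum, Finset.sum_mul, ← Finset.sum_sub_distrib]
    refine Finset.sum_congr rfl fun m _ => ?_
    simp only [mul_pow, Finset.prod_mul_distrib, map_mul, map_prod, map_pow, eval_C, eval_X,
      map_natCast]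
    ring
  rw [hexp]
  exact sum_mem fun m hm => Ideal.mul_mem_left _ _
    (h m (Finset.Nat.mem_antidiagonalTuple.mp hm))

theorem IsAssocCoeffsT.jacPoly_notMem {n d : ℕ} (hn : 2 ≤ n) (hd : 3 ≤ d)
    {f : Fin n → MvPolynomial (Fin n) ℂ} (hf : ∀ i, (f i).IsHomogeneous (d - 1))
    {μ : (Fin n → ℕ) → ℂ} (h : IsAssocCoeffsT n d f μ) :
    jacPoly n f ∉ Ideal.span (Set.range f) := by
  intro hJ
  have hsub : d - 1 - 1 = d - 2 := by omega
  have hle : d - 1 ≤ n * (d - 2) :=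
    le_trans (by omega) (Nat.mul_le_mul_right (d - 2) hn)
  obtain ⟨m, hm, hmem⟩ := exists_monomial_notMem_span (by omega) f hf
    (by rwa [Fintype.card_fin, hsub])
  rw [Fintype.card_fin, hsub] at hm
  apply hmem
  have := add_mem (h m hm) (Ideal.mul_mem_left _ (C (μ m)) hJ)
  rw [sub_add_cancel] at this
  rwa [monomial_eq, C_1, one_mul, Finsupp.prod_fintype _ _ (by simp)]

theorem aeval_linear_comp_inv {n : ℕ} {A B : Matrix (Fin n) (Fin n) ℂ} (h : A * B = 1)
    (q : MvPolynomial (Fin n) ℂ) :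
    aeval (fun k => ∑ l, B k l • (X l : MvPolynomial (Fin n) ℂ))
      (aeval (fun k => ∑ l, A k l • (X l : MvPolynomial (Fin n) ℂ)) q) = q := by
  have hc : (aeval (fun k => ∑ l, B k l • (X l : MvPolynomial (Fin n) ℂ))).comp
      (aeval (fun k => ∑ l, A k l • (X l : MvPolynomial (Fin n) ℂ))) = AlgHom.id ℂ _ := by
    ext1 k
    simp only [AlgHom.comp_apply, aeval_X, map_sum, map_smul, Finset.smul_sum, smul_smul,
      AlgHom.id_apply]
    rw [Finset.sum_comm]
    simp only [← Finset.sum_smul, ← Matrix.mul_apply, h, Matrix.one_apply]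
    simp
  exact DFunLike.congr_fun hc q

/-- Equivariance of the associated form of an `n`-tuple: for a tuple `𝔣` of
degree `d-1` forms with only common zero the origin and `C₁, C₂ ∈ GL_n(ℂ)`, the tuple
`(C₁,C₂)𝔣 : z ↦ 𝔣(zC₁^{-T})C₂^{-1}` has no common zero away from the origin, and its
associated form equals `det(C₁C₂)` times `e ↦ 𝐟(eC₁)`, where `𝐟` is the associated form
of `𝔣`. -/
theorem assocForm_tuple_equivariance
    (n d : ℕ) (hn : 2 ≤ n) (hd : 3 ≤ d)
    (f : Fin n → MvPolynomial (Fin n) ℂ)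
    (hf : ∀ i, (f i).IsHomogeneous (d - 1))
    (hzero : ∀ p : Fin n → ℂ, (∀ i, eval p (f i) = 0) → p = 0)
    (C₁ C₂ : Matrix (Fin n) (Fin n) ℂ) (hC₁ : IsUnit C₁.det) (hC₂ : IsUnit C₂.det)
    (μ μ' : (Fin n → ℕ) → ℂ)
    (hμ : IsAssocCoeffsT n d f μ)
    (hμ' : IsAssocCoeffsT n d
      (fun i => ∑ j, C₂⁻¹ j i • aeval (fun k => ∑ l, C₁⁻¹ k l • X l) (f j)) μ') :
    (∀ p : Fin n → ℂ,
        (∀ i, eval p (∑ j, C₂⁻¹ j i • aeval (fun k => ∑ l, C₁⁻¹ k l • X l) (f j)) = 0)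
          → p = 0)
      ∧ assocForm n d μ'
          = (C₁.det * C₂.det) • aeval (fun i => ∑ j, C₁ j i • X j) (assocForm n d μ) := by
  have h₁ : C₁⁻¹ * C₁ = 1 := Matrix.nonsing_inv_mul _ hC₁
  have h₂ : C₂ * C₂⁻¹ = 1 := Matrix.mul_nonsing_inv _ hC₂
  refine ⟨fun p hp => ?_, ?_⟩
  · have hev : ∀ j, eval p (aeval (fun k => ∑ l, C₁⁻¹ k l • X l) (f j)) =
        eval (C₁⁻¹.mulVec p) (f j) := fun j => by
      rw [← aeval_eq_eval, ← aeval_eq_eval, ← AlgHom.comp_apply, comp_aeval]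
      congr 2
      funext k
      simp [Matrix.mulVec, dotProduct]
    have hv : Matrix.vecMul (fun j => eval (C₁⁻¹.mulVec p) (f j)) C₂⁻¹ = 0 := by
      funext i
      have := hp i
      simp only [map_sum, smul_eval, hev] at this
      simpa [Matrix.vecMul, dotProduct, mul_comm] using this
    have hv0 : (fun j => eval (C₁⁻¹.mulVec p) (f j)) = 0 := by
      have := congrArg (Matrix.vecMul · C₂) hv
      simpa [Matrix.vecMul_vecMul, Matrix.nonsing_inv_mul _ hC₂] using this
    have hp0 := congrArg C₁.mulVec (hzero _ (congrFun hv0))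
    simpa [Matrix.mulVec_mulVec, Matrix.mul_nonsing_inv _ hC₁] using hp0
  · refine MvPolynomial.funext fun e => ?_
    set ψ : MvPolynomial (Fin n) ℂ →ₐ[ℂ] MvPolynomial (Fin n) ℂ :=
      aeval (fun k => ∑ l, C₁ k l • X l) with hψ
    have hmap : (Ideal.span (Set.range fun i =>
        ∑ j, C₂⁻¹ j i • aeval (fun k => ∑ l, C₁⁻¹ k l • X l) (f j))).map ψ ≤
        Ideal.span (Set.range f) := by
      rw [Ideal.map_span, Ideal.span_le]
      rintro _ ⟨_, ⟨i, rfl⟩, rfl⟩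
      rw [map_sum]
      refine sum_mem fun j _ => ?_
      rw [map_smul, hψ, aeval_linear_comp_inv h₁, smul_eq_C_mul]
      exact Ideal.mul_mem_left _ _ (Ideal.subset_span (Set.mem_range_self j))
    have hpow' := hmap (Ideal.mem_map_of_mem ψ (hμ'.linear_pow_sub_mem e))
    have hpow := hμ.linear_pow_sub_mem (Matrix.vecMul e C₁)
    have hlin : ψ (∑ i, C (e i) * X i) = ∑ i, C (Matrix.vecMul e C₁ i) * X i := by
      simp only [hψ, map_sum, map_mul, aeval_X, aeval_C, algebraMap_eq, Matrix.vecMul, dotProduct,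
        smul_eq_C_mul, Finset.mul_sum, Finset.sum_mul]
      rw [Finset.sum_comm]
      simp only [mul_assoc]
    rw [jacPoly_linear_change, map_sub, map_pow, hlin, map_mul, map_mul, hψ,
      aeval_linear_comp_inv h₁, aeval_C, aeval_C, algebraMap_eq, ← mul_assoc, ← map_mul] at hpow'
    have hdiff := sub_mem hpow hpow'
    rw [sub_sub_sub_cancel_left, ← sub_mul, ← map_sub] at hdiff
    have hzero' : eval e (assocForm n d μ') * (C₁⁻¹.det * C₂⁻¹.det) -
        eval (Matrix.vecMul e C₁) (assocForm n d μ) = 0 := by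
      by_contra hne
      refine hμ.jacPoly_notMem hn hd hf ?_
      have := Ideal.mul_mem_left _ (C (eval e (assocForm n d μ') * (C₁⁻¹.det * C₂⁻¹.det) -
        eval (Matrix.vecMul e C₁) (assocForm n d μ))⁻¹) hdiff
      rwa [← mul_assoc, ← map_mul, inv_mul_cancel₀ hne, C_1, one_mul] at this
    have hev : eval e (aeval (fun i => ∑ j, C₁ j i • X j) (assocForm n d μ)) =
        eval (Matrix.vecMul e C₁) (assocForm n d μ) := by
      rw [← aeval_eq_eval, ← aeval_eq_eval, ← AlgHom.comp_apply, comp_aeval]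
      congr 2
      funext k
      simp [Matrix.vecMul, dotProduct, mul_comm]
    have hd₁ : C₁⁻¹.det * C₁.det = 1 := by rw [← Matrix.det_mul, h₁, Matrix.det_one]
    have hd₂ : C₂.det * C₂⁻¹.det = 1 := by rw [← Matrix.det_mul, h₂, Matrix.det_one]
    rw [smul_eval, hev]
    linear_combination (C₁.det * C₂.det) * hzero' -
      eval e (assocForm n d μ') * (C₂.det * C₂⁻¹.det * hd₁ + hd₂)
end
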